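/- Let B = ⊕_{n≥0} B_n be a reduced standard graded algebra over a field k and let A = ⊕_{n≥0} A_n be a standard graded k-subalgebra of B. Then the limit lim_{n→∞} ((dim B − 1)!/n^{dim B − 1}) · dim_k(B_n/A_n) exists and is finite; i.e., the relative ε-multiplicity ε(A | B) over the field k, defined as the limsup of this sequence, is realized as a finite limit. -/

import Mathlib

open Polynomial in
theorem Polynomial.exists_eval_add_one_sub_eval_eq (P : ℚ[X]) :
    ∃ Q : ℚ[X], ∀ x : ℚ, Q.eval (x + 1) - Q.eval x = P.eval x := by
  induction P using Polynomial.induction_on' with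
  | add p q hp hq =>
    obtain ⟨p', hp'⟩ := hp
    obtain ⟨q', hq'⟩ := hq
    refine ⟨p' + q', fun x => ?_⟩
    rw [eval_add, eval_add, eval_add, ← hp', ← hq']
    ring
  | monomial n a =>
    refine ⟨C (a / (n + 1)) * Polynomial.bernoulli (n + 1), fun x => ?_⟩
    have : (n : ℚ) + 1 ≠ 0 := by positivity
    rw [eval_mul, eval_mul, eval_C, eval_C, add_comm x 1, bernoulli_eval_one_add, eval_monomial,
      Nat.add_sub_cancel]
    push_cast
    field_simp
    ring

/-- A sequence of rational numbers that agrees with a polynomial for all large indices. -/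
def EventuallyPolynomial (f : ℕ → ℚ) : Prop :=
  ∃ P : Polynomial ℚ, ∀ᶠ n : ℕ in Filter.atTop, f n = P.eval (n : ℚ)

namespace EventuallyPolynomial

open Filter Polynomial

theorem of_eventually_eq_zero {f : ℕ → ℚ} (h : ∀ᶠ n in atTop, f n = 0) :
    EventuallyPolynomial f :=
  ⟨0, by simpa using h⟩

theorem add {f g : ℕ → ℚ} (hf : EventuallyPolynomial f) (hg : EventuallyPolynomial g) :
    EventuallyPolynomial (fun n => f n + g n) := by
  obtain ⟨P, hP⟩ := hf
  obtain ⟨Q, hQ⟩ := hg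
  refine ⟨P + Q, ?_⟩
  filter_upwards [hP, hQ] with n h₁ h₂
  rw [h₁, h₂, eval_add]

theorem sub {f g : ℕ → ℚ} (hf : EventuallyPolynomial f) (hg : EventuallyPolynomial g) :
    EventuallyPolynomial (fun n => f n - g n) := by
  obtain ⟨P, hP⟩ := hf
  obtain ⟨Q, hQ⟩ := hg
  refine ⟨P - Q, ?_⟩
  filter_upwards [hP, hQ] with n h₁ h₂
  rw [h₁, h₂, eval_sub]

theorem comp_succ {f : ℕ → ℚ} (hf : EventuallyPolynomial f) :
    EventuallyPolynomial (fun n => f (n + 1)) := by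
  obtain ⟨P, hP⟩ := hf
  refine ⟨P.comp (X + 1), ?_⟩
  filter_upwards [(tendsto_add_atTop_nat 1).eventually hP] with n h
  rw [h]
  simp

theorem of_comp_succ {f : ℕ → ℚ} (hf : EventuallyPolynomial (fun n => f (n + 1))) :
    EventuallyPolynomial f := by
  obtain ⟨P, hP⟩ := hf
  obtain ⟨N, hN⟩ := eventually_atTop.1 hP
  refine ⟨P.comp (X - 1), eventually_atTop.2 ⟨N + 1, fun n hn => ?_⟩⟩
  obtain ⟨m, rfl⟩ : ∃ m, n = m + 1 := ⟨n - 1, by omega⟩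
  refine (hN m (by omega)).trans ?_
  simp

theorem of_forwardDiff {f : ℕ → ℚ} (hf : EventuallyPolynomial (fun n => f (n + 1) - f n)) :
    EventuallyPolynomial f := by
  obtain ⟨P, hP⟩ := hf
  obtain ⟨Q, hQ⟩ := P.exists_eval_add_one_sub_eval_eq
  obtain ⟨N, hN⟩ := eventually_atTop.1 hP
  refine ⟨Q + C (f N - Q.eval (N : ℚ)), eventually_atTop.2 ⟨N, fun n hn => ?_⟩⟩
  induction n, hn using Nat.le_induction with
  | base => simp
  | succ n hn ih =>
    have h₁ := hN n hn
    have h₂ := hQ n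
    simp only [eval_add, eval_C] at ih ⊢
    push_cast
    linarith

end EventuallyPolynomial

section Hilbert

open MvPolynomial

variable {σ k : Type*} [Field k]

/-- An ideal containing all homogeneous components of its elements. -/
def MvPolynomial.ComponentClosed (I : Ideal (MvPolynomial σ k)) : Prop :=
  ∀ p ∈ I, ∀ n, homogeneousComponent n p ∈ I

theorem MvPolynomial.homogeneousComponent_succ_X_mul (a : σ) (n : ℕ) (p : MvPolynomial σ k) :
    homogeneousComponent (n + 1) (X a * p) = X a * homogeneousComponent n p := by
  classical
  ext d
  rw [coeff_homogeneousComponent, coeff_X_mul', coeff_X_mul', coeff_homogeneousComponent]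
  by_cases h : a ∈ d.support
  · have h1 : Finsupp.single a 1 ≤ d := by
      simpa [Nat.one_le_iff_ne_zero] using h
    have h2 : d.degree = (d - Finsupp.single a 1).degree + 1 := by
      conv_lhs => rw [← tsub_add_cancel_of_le h1]
      simp [map_add]
    simp [h, h2]
  · simp [h]

theorem MvPolynomial.homogeneousComponent_zero_X_mul (a : σ) (p : MvPolynomial σ k) :
    homogeneousComponent 0 (X a * p) = 0 := by
  classical
  rw [homogeneousComponent_zero, coeff_X_mul']
  simp

/-- The ideal quotient `I : X a`. -/
noncomputable def MvPolynomial.colonX (I : Ideal (MvPolynomial σ k)) (a : σ) :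
    Ideal (MvPolynomial σ k) :=
  Submodule.comap (LinearMap.mulLeft (MvPolynomial σ k) (X a)) I

theorem MvPolynomial.mem_colonX {I : Ideal (MvPolynomial σ k)} {a : σ} {p : MvPolynomial σ k} :
    p ∈ colonX I a ↔ X a * p ∈ I :=
  Iff.rfl

theorem MvPolynomial.le_colonX (I : Ideal (MvPolynomial σ k)) (a : σ) : I ≤ colonX I a :=
  fun _ hp => mem_colonX.2 (I.mul_mem_left _ hp)

theorem MvPolynomial.ComponentClosed.colonX {I : Ideal (MvPolynomial σ k)}
    (hI : ComponentClosed I) (a : σ) : ComponentClosed (colonX I a) := by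
  intro p hp n
  rw [mem_colonX, ← homogeneousComponent_succ_X_mul]
  exact hI _ hp _

theorem MvPolynomial.ComponentClosed.sup_span_X {I : Ideal (MvPolynomial σ k)}
    (hI : ComponentClosed I) (a : σ) : ComponentClosed (I ⊔ Ideal.span {X a}) := by
  intro p hp n
  obtain ⟨q, hq, r, hr, rfl⟩ := Submodule.mem_sup.1 hp
  obtain ⟨s, rfl⟩ := Ideal.mem_span_singleton'.1 hr
  rw [map_add, mul_comm s]
  refine add_mem (Ideal.mem_sup_left (hI q hq n)) (Ideal.mem_sup_right ?_)
  cases n with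
  | zero => rw [homogeneousComponent_zero_X_mul]; exact zero_mem _
  | succ n =>
    rw [homogeneousComponent_succ_X_mul]
    exact Ideal.mul_mem_right _ _ (Ideal.mem_span_singleton_self _)

/-- The degree-`n` part of an ideal of a polynomial ring. -/
noncomputable abbrev MvPolynomial.degreePart (I : Ideal (MvPolynomial σ k)) (n : ℕ) :
    Submodule k (MvPolynomial σ k) :=
  homogeneousSubmodule σ k n ⊓ I.restrictScalars k

/-- The Hilbert function of the quotient of a polynomial ring by an ideal. -/
noncomputable def MvPolynomial.hilbertFun (I : Ideal (MvPolynomial σ k)) (n : ℕ) : ℚ :=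
  Module.finrank k (homogeneousSubmodule σ k n) - Module.finrank k (degreePart I n)

theorem MvPolynomial.hilbertFun_succ [Finite σ] {I : Ideal (MvPolynomial σ k)}
    (hI : ComponentClosed I) (a : σ) (n : ℕ) :
    hilbertFun I (n + 1) =
      hilbertFun (I ⊔ Ideal.span {X a}) (n + 1) + hilbertFun (colonX I a) n := by
  have hfin (m : ℕ) : Module.Finite k (homogeneousSubmodule σ k m) :=
    Module.Finite.iff_fg.2 (homogeneousSubmodule_fg σ k m)
  have hfin' (J : Ideal (MvPolynomial σ k)) (m : ℕ) : Module.Finite k (degreePart J m) :=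
    Submodule.finiteDimensional_of_le inf_le_left
  set μ : MvPolynomial σ k →ₗ[k] MvPolynomial σ k := LinearMap.mulLeft k (X a) with hμ
  have hinj : Function.Injective μ := fun p q h => mul_left_cancel₀ (X_ne_zero a) h
  have hdim (V : Submodule k (MvPolynomial σ k)) :
      Module.finrank k (V.map μ) = Module.finrank k V :=
    (Submodule.equivMapOfInjective μ hinj V).finrank_eq.symm
  have hX (p : MvPolynomial σ k) (hp : p ∈ homogeneousSubmodule σ k n) :
      X a * p ∈ homogeneousSubmodule σ k (n + 1) := by
    rw [add_comm]
    exact (isHomogeneous_X k a).mul hp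
  have hsup : degreePart (I ⊔ Ideal.span {X a}) (n + 1) =
      degreePart I (n + 1) ⊔ (homogeneousSubmodule σ k n).map μ := by
    apply le_antisymm
    · rintro p ⟨hp, hp'⟩
      obtain ⟨q, hq, r, hr, rfl⟩ := Submodule.mem_sup.1 hp'
      obtain ⟨s, rfl⟩ := Ideal.mem_span_singleton'.1 hr
      rw [← homogeneousComponent_eq_self (n := n + 1) hp, map_add, mul_comm s,
        homogeneousComponent_succ_X_mul]
      exact Submodule.add_mem_sup ⟨homogeneousComponent_mem _ _, hI q hq _⟩
        ⟨_, homogeneousComponent_mem _ _, rfl⟩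
    · refine sup_le (inf_le_inf_left _ fun p hp => Ideal.mem_sup_left hp) ?_
      rintro _ ⟨p, hp, rfl⟩
      exact ⟨hX p hp, Ideal.mem_sup_right
        (Ideal.mul_mem_right _ _ (Ideal.mem_span_singleton_self _))⟩
  have hinf : degreePart I (n + 1) ⊓ (homogeneousSubmodule σ k n).map μ =
      (degreePart (colonX I a) n).map μ := by
    ext p
    constructor
    · rintro ⟨⟨-, hp⟩, q, hq, rfl⟩
      exact ⟨q, ⟨hq, hp⟩, rfl⟩
    · rintro ⟨q, ⟨hq, hq'⟩, rfl⟩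
      exact ⟨⟨hX q hq, hq'⟩, q, hq, rfl⟩
  have key := Submodule.finrank_sup_add_finrank_inf_eq (degreePart I (n + 1))
    ((homogeneousSubmodule σ k n).map μ)
  rw [← hsup, hinf, hdim, hdim] at key
  have key' := congrArg (Nat.cast : ℕ → ℚ) key
  push_cast at key'
  simp only [hilbertFun]
  linarith

theorem MvPolynomial.eventuallyPolynomial_hilbertFun [Finite σ] {I : Ideal (MvPolynomial σ k)}
    (hI : ComponentClosed I) : EventuallyPolynomial (hilbertFun I) := by
  classical
  have := Fintype.ofFinite σ
  suffices H : ∀ s : Finset σ, ∀ I : Ideal (MvPolynomial σ k), ComponentClosed I →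
      (∀ i ∉ s, X i ∈ I) → EventuallyPolynomial (hilbertFun I) from
    H Finset.univ I hI (by simp)
  intro s
  induction s using Finset.induction_on with
  | empty =>
    intro I _ hX
    refine .of_eventually_eq_zero (Filter.eventually_atTop.2 ⟨1, fun n hn => ?_⟩)
    have h1 : homogeneousSubmodule σ k n ≤ I.restrictScalars k := by
      obtain ⟨m, rfl⟩ : ∃ m, n = m + 1 := ⟨n - 1, by omega⟩
      rw [← homogeneousSubmodule_one_pow, pow_succ, Submodule.mul_le]
      intro p _ q hq
      refine I.mul_mem_left _ ?_
      rw [homogeneousSubmodule_one_eq_span_X] at hq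
      refine (Submodule.span_le (p := I.restrictScalars k)).2 ?_ hq
      rintro _ ⟨i, rfl⟩
      exact hX i (by simp)
    rw [hilbertFun, degreePart, inf_eq_left.2 h1, sub_self]
  | insert a s _ ihs =>
    intro I
    induction I using IsWellFounded.induction (α := Ideal (MvPolynomial σ k)) (· > ·) with
    | ind I ihI =>
    intro hI hX
    have hL : EventuallyPolynomial (hilbertFun (I ⊔ Ideal.span {X a})) := by
      refine ihs _ (hI.sup_span_X a) fun i hi => ?_
      by_cases hia : i = a
      · rw [hia]
        exact Ideal.mem_sup_right (Ideal.mem_span_singleton_self _)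
      · exact Ideal.mem_sup_left (hX i (by simp [hia, hi]))
    rcases (le_colonX I a).eq_or_lt with h | h
    · refine .of_forwardDiff ?_
      have : (fun n => hilbertFun I (n + 1) - hilbertFun I n) =
          fun n => hilbertFun (I ⊔ Ideal.span {X a}) (n + 1) := by
        funext n
        rw [hilbertFun_succ hI a, ← h]
        ring
      rw [this]
      exact hL.comp_succ
    · refine .of_comp_succ ?_
      simp only [hilbertFun_succ hI a]
      exact hL.comp_succ.add
        (ihI _ h (hI.colonX a) fun i hi => le_colonX I a (hX i hi))

end Hilbert

theorem ringKrullDim_le_of_isIntegral (R S : Type*) [CommRing R] [CommRing S] [Algebra R S]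
    [FaithfulSMul R S] [Algebra.IsIntegral R S] : ringKrullDim R ≤ ringKrullDim S := by
  refine iSup_le fun l => ?_
  obtain ⟨P, hP, hPl⟩ := Ideal.nonempty_primesOver (S := S) l.head.asIdeal
  obtain ⟨L, hL, -, -⟩ := Ideal.exists_ltSeries_of_hasGoingUp l P
  rw [← hL]
  exact Order.LTSeries.length_le_krullDim L

section Growth

variable {k B : Type*} [Field k] [CommRing B] [Algebra k B]

/-- The span of the monomials in `y` all of whose exponents are at most `N`. -/
def boxSpan (k : Type*) [Field k] [Algebra k B] {s : ℕ} (y : Fin s → B) (N : ℕ) :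
    Submodule k B :=
  Submodule.span k (Set.range fun a : Fin s → Fin (N + 1) => ∏ i, y i ^ (a i : ℕ))

theorem prod_pow_mem_boxSpan {s : ℕ} (y : Fin s → B) {N : ℕ} (a : Fin s → ℕ)
    (ha : ∀ i, a i ≤ N) : ∏ i, y i ^ a i ∈ boxSpan k y N :=
  Submodule.subset_span ⟨fun i => ⟨a i, Nat.lt_succ_of_le (ha i)⟩, rfl⟩

theorem boxSpan_mono {s : ℕ} (y : Fin s → B) : Monotone (boxSpan k y) := by
  intro N M h
  refine Submodule.span_le.2 ?_
  rintro _ ⟨a, rfl⟩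
  exact prod_pow_mem_boxSpan y _ fun i => by have := (a i).2; omega

theorem boxSpan_mul_le {s : ℕ} (y : Fin s → B) (N M : ℕ) :
    boxSpan k y N * boxSpan k y M ≤ boxSpan k y (N + M) := by
  rw [boxSpan, boxSpan, Submodule.span_mul_span, Submodule.span_le]
  rintro _ ⟨_, ⟨a, rfl⟩, _, ⟨b, rfl⟩, rfl⟩
  simp only [← Finset.prod_mul_distrib, ← pow_add]
  exact prod_pow_mem_boxSpan y _ fun i => by have := (a i).2; have := (b i).2; omega

theorem boxSpan_pow_le {s : ℕ} (y : Fin s → B) (N m : ℕ) :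
    boxSpan k y N ^ m ≤ boxSpan k y (N * m) := by
  induction m with
  | zero =>
    rw [pow_zero, Submodule.one_le]
    simpa using prod_pow_mem_boxSpan (k := k) y (N := N * 0) 0 (by simp)
  | succ m ih =>
    rw [pow_succ, Nat.mul_succ]
    exact (mul_le_mul_left ih _).trans (boxSpan_mul_le y _ _)

theorem span_mul_boxSpan {s : ℕ} (y : Fin s → B) (T : Finset B) (N : ℕ) :
    Submodule.span k (T : Set B) * boxSpan k y N = Submodule.span k
      (Set.range fun x : T × (Fin s → Fin (N + 1)) => (x.1 : B) * ∏ i, y i ^ (x.2 i : ℕ)) := by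
  rw [boxSpan, Submodule.span_mul_span]
  congr 1
  ext b
  constructor
  · rintro ⟨t, ht, _, ⟨a, rfl⟩, rfl⟩
    exact ⟨(⟨t, ht⟩, a), rfl⟩
  · rintro ⟨⟨⟨t, ht⟩, a⟩, rfl⟩
    exact ⟨t, ht, _, ⟨a, rfl⟩, rfl⟩

theorem finite_span_mul_boxSpan {s : ℕ} (y : Fin s → B) (T : Finset B) (N : ℕ) :
    Module.Finite k ↥(Submodule.span k (T : Set B) * boxSpan k y N) := by
  rw [span_mul_boxSpan]
  exact Module.Finite.span_of_finite k (Set.finite_range _)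

theorem finrank_span_mul_boxSpan_le {s : ℕ} (y : Fin s → B) (T : Finset B) (N : ℕ) :
    Module.finrank k ↥(Submodule.span k (T : Set B) * boxSpan k y N) ≤
      T.card * (N + 1) ^ s := by
  rw [span_mul_boxSpan]
  refine (finrank_range_le_card _).trans ?_
  simp

theorem exists_mem_span_mul_boxSpan {s : ℕ} (g : MvPolynomial (Fin s) k →ₐ[k] B)
    {T : Finset B}
    (hT : ∀ b : B, ∃ q : B → MvPolynomial (Fin s) k, b = ∑ t ∈ T, g (q t) * t) (b : B) :
    ∃ c, b ∈ Submodule.span k (T : Set B) * boxSpan k (fun i => g (.X i)) c := by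
  set y : Fin s → B := fun i => g (.X i) with hy
  have hadd {b b' : B} (h : ∃ c, b ∈ Submodule.span k (T : Set B) * boxSpan k y c)
      (h' : ∃ c, b' ∈ Submodule.span k (T : Set B) * boxSpan k y c) :
      ∃ c, b + b' ∈ Submodule.span k (T : Set B) * boxSpan k y c := by
    obtain ⟨c, hc⟩ := h
    obtain ⟨c', hc'⟩ := h'
    exact ⟨max c c', add_mem (mul_le_mul_right (boxSpan_mono y (le_max_left _ _)) _ hc)
      (mul_le_mul_right (boxSpan_mono y (le_max_right _ _)) _ hc')⟩
  have hpoly (p : MvPolynomial (Fin s) k) : ∃ c, g p ∈ boxSpan k y c := by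
    induction p using MvPolynomial.induction_on' with
    | monomial u a =>
      refine ⟨u.degree, ?_⟩
      rw [← mul_one a, ← smul_eq_mul, ← MvPolynomial.smul_monomial, map_smul,
        MvPolynomial.monomial_eq, Finsupp.prod_fintype _ _ (by simp)]
      simp only [map_prod, map_pow, map_one, one_mul]
      exact Submodule.smul_mem _ _ (prod_pow_mem_boxSpan y _ fun i => Finsupp.le_degree i u)
    | add p q hp hq =>
      obtain ⟨c, hc⟩ := hp
      obtain ⟨c', hc'⟩ := hq
      rw [map_add]
      exact ⟨max c c', add_mem (boxSpan_mono y (le_max_left _ _) hc)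
        (boxSpan_mono y (le_max_right _ _) hc')⟩
  obtain ⟨q, rfl⟩ := hT b
  refine Finset.sum_induction _
    (fun b => ∃ c, b ∈ Submodule.span k (T : Set B) * boxSpan k y c)
    (fun _ _ => hadd) ⟨0, zero_mem _⟩ fun t ht => ?_
  obtain ⟨c, hc⟩ := hpoly (q t)
  exact ⟨c, mul_comm t (g (q t)) ▸ Submodule.mul_mem_mul (Submodule.subset_span ht) hc⟩

theorem Submodule.FG.exists_le_span_mul_boxSpan {s : ℕ} (g : MvPolynomial (Fin s) k →ₐ[k] B)
    {T : Finset B}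
    (hT : ∀ b : B, ∃ q : B → MvPolynomial (Fin s) k, b = ∑ t ∈ T, g (q t) * t)
    {F : Submodule k B} (hF : F.FG) :
    ∃ c, F ≤ Submodule.span k (T : Set B) * boxSpan k (fun i => g (.X i)) c := by
  obtain ⟨S, rfl⟩ := hF
  choose c hc using exists_mem_span_mul_boxSpan g hT
  refine ⟨S.sup c, Submodule.span_le.2 fun b hb => ?_⟩
  exact mul_le_mul_right (boxSpan_mono _ (Finset.le_sup hb)) _ (hc b)

theorem Finset.SupIndep.sum_finrank_eq {V ι : Type*} [AddCommGroup V] [Module k V]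
    {W : ι → Submodule k V} [∀ i, Module.Finite k (W i)] {S : Finset ι} (h : S.SupIndep W) :
    ∑ i ∈ S, Module.finrank k (W i) = Module.finrank k ↥(S.sup W) := by
  classical
  induction S using Finset.induction_on with
  | empty => rw [Finset.sum_empty, Finset.sup_empty, finrank_bot]
  | insert a S ha ih =>
    have hd : Disjoint (W a) (S.sup W) :=
      h (Finset.subset_insert a S) (Finset.mem_insert_self a S) ha
    have := Submodule.finrank_sup_add_finrank_inf_eq (W a) (S.sup W)
    rw [hd.eq_bot, finrank_bot, add_zero] at this
    rw [Finset.sum_insert ha, Finset.sup_insert, this, ih (h.subset (Finset.subset_insert a S))]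

theorem GradedAlgebra.finiteType_of_eq_pow (𝒜 : ℕ → Submodule k B) [GradedAlgebra 𝒜]
    (hstd : ∀ n, 𝒜 n = 𝒜 1 ^ n) (hfg : (𝒜 1).FG) : Algebra.FiniteType k B := by
  classical
  obtain ⟨S, hS⟩ := hfg
  refine ⟨⟨S, eq_top_iff.2 fun b _ => ?_⟩⟩
  have h (n : ℕ) : 𝒜 n ≤ Subalgebra.toSubmodule (Algebra.adjoin k (S : Set B)) := by
    rw [hstd n, ← hS]
    induction n with
    | zero =>
      rw [pow_zero, Submodule.one_le]
      exact one_mem (Algebra.adjoin k (S : Set B))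
    | succ n ih =>
      rw [pow_succ, Submodule.mul_le]
      exact fun x hx y hy =>
        mul_mem (S := Subalgebra k B) (ih hx) (Algebra.span_le_adjoin k _ hy)
  rw [← DirectSum.sum_support_decompose 𝒜 b]
  exact sum_mem fun n _ => h n (SetLike.coe_mem _)

/-- The dimension of the truncation of a standard graded algebra below degree `N` grows at most
like `N ^ d`, where `d` is the Krull dimension. -/
theorem GradedAlgebra.exists_sum_finrank_le (𝒜 : ℕ → Submodule k B) [GradedAlgebra 𝒜]
    (hstd : ∀ n, 𝒜 n = 𝒜 1 ^ n) (hfg : (𝒜 1).FG) {d : ℕ} (hd : ringKrullDim B = d) :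
    ∃ C : ℕ, ∀ N, 0 < N → ∑ n ∈ Finset.range N, Module.finrank k (𝒜 n) ≤ C * N ^ d := by
  have hnt : Nontrivial B := by
    by_contra h
    rw [not_nontrivial_iff_subsingleton] at h
    rw [ringKrullDim_eq_bot_of_subsingleton] at hd
    exact absurd hd (by simp)
  have hft := finiteType_of_eq_pow 𝒜 hstd hfg
  have hfin (n : ℕ) : Module.Finite k (𝒜 n) := by
    rw [hstd n]
    exact Module.Finite.iff_fg.2 (hfg.pow n)
  obtain ⟨s, g, hg, hgfin⟩ := exists_finite_inj_algHom_of_fg k B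
  let _ : Algebra (MvPolynomial (Fin s) k) B := g.toRingHom.toAlgebra
  have hmf : Module.Finite (MvPolynomial (Fin s) k) B := hgfin
  have hsd : s ≤ d := by
    have hinj : FaithfulSMul (MvPolynomial (Fin s) k) B :=
      (faithfulSMul_iff_algebraMap_injective _ _).2 hg
    have h1 := ringKrullDim_le_of_isIntegral (MvPolynomial (Fin s) k) B
    rw [MvPolynomial.ringKrullDim_of_isNoetherianRing, ringKrullDim_eq_zero_of_field, hd,
      zero_add, Nat.card_fin] at h1
    exact_mod_cast h1
  obtain ⟨T, hT⟩ := hmf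
  have hT' (b : B) : ∃ q : B → MvPolynomial (Fin s) k, b = ∑ t ∈ T, g (q t) * t := by
    have hb : b ∈ Submodule.span (MvPolynomial (Fin s) k) (T : Set B) := hT ▸ Submodule.mem_top
    obtain ⟨q, -, hq⟩ := Submodule.mem_span_finset.1 hb
    exact ⟨q, hq.symm⟩
  set P := Submodule.span k (T : Set B) with hP
  set V := boxSpan k (fun i => g (.X i)) with hV
  obtain ⟨c₀, hc₀⟩ := Submodule.FG.exists_le_span_mul_boxSpan g hT'
    (F := 1) (by rw [Submodule.one_eq_span]; exact Submodule.fg_span_singleton 1)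
  obtain ⟨c, hc⟩ := Submodule.FG.exists_le_span_mul_boxSpan g hT'
    (F := 𝒜 1 * P) (hfg.mul (Submodule.fg_span T.finite_toSet))
  have hpow (n : ℕ) : 𝒜 1 ^ n * P ≤ P * V c ^ n := by
    induction n with
    | zero => simp
    | succ n ih =>
      calc 𝒜 1 ^ (n + 1) * P = 𝒜 1 ^ n * (𝒜 1 * P) := by rw [pow_succ, mul_assoc]
        _ ≤ 𝒜 1 ^ n * (P * V c) := mul_le_mul_right hc _
        _ = (𝒜 1 ^ n * P) * V c := by rw [mul_assoc]
        _ ≤ (P * V c ^ n) * V c := mul_le_mul_left ih _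
        _ = P * V c ^ (n + 1) := by rw [mul_assoc, pow_succ]
  have hle (n N : ℕ) (hn : n ≤ N) : 𝒜 n ≤ P * V (c * N + c₀) := by
    calc 𝒜 n = 𝒜 1 ^ n * 1 := by rw [mul_one, ← hstd]
      _ ≤ 𝒜 1 ^ n * (P * V c₀) := mul_le_mul_right hc₀ _
      _ = (𝒜 1 ^ n * P) * V c₀ := by rw [mul_assoc]
      _ ≤ (P * V c ^ n) * V c₀ := mul_le_mul_left (hpow n) _
      _ ≤ (P * V (c * n)) * V c₀ := by gcongr; exact boxSpan_pow_le _ _ _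
      _ = P * (V (c * n) * V c₀) := mul_assoc _ _ _
      _ ≤ P * V (c * n + c₀) := by gcongr; exact boxSpan_mul_le _ _ _
      _ ≤ P * V (c * N + c₀) := by gcongr; exact boxSpan_mono _ (by gcongr)
  have hind : iSupIndep 𝒜 := (DirectSum.Decomposition.isInternal 𝒜).submodule_iSupIndep
  refine ⟨T.card * (c + c₀ + 1) ^ d, fun N hN => ?_⟩
  have hfinV := finite_span_mul_boxSpan (k := k) (fun i => g (.X i)) T (c * N + c₀)
  calc ∑ n ∈ Finset.range N, Module.finrank k (𝒜 n)
      = Module.finrank k ↥((Finset.range N).sup 𝒜) :=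
        (hind.supIndep' _).sum_finrank_eq
    _ ≤ Module.finrank k ↥(P * V (c * N + c₀)) :=
        Submodule.finrank_mono (Finset.sup_le fun n hn => hle n N (Finset.mem_range.1 hn).le)
    _ ≤ T.card * (c * N + c₀ + 1) ^ s := finrank_span_mul_boxSpan_le _ _ _
    _ ≤ T.card * (c * N + c₀ + 1) ^ d := by gcongr; omega
    _ ≤ T.card * ((c + c₀ + 1) * N) ^ d := by
        gcongr
        nlinarith
    _ = T.card * (c + c₀ + 1) ^ d * N ^ d := by rw [mul_pow, mul_assoc]

end Growth

section PowerSubmodule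

open MvPolynomial

variable {k B : Type*} [Field k] [CommRing B] [Algebra k B]

theorem Submodule.finrank_map_add_finrank_inf_ker {V W : Type*} [AddCommGroup V] [Module k V]
    [AddCommGroup W] [Module k W] (f : V →ₗ[k] W) (U : Submodule k V) [Module.Finite k U] :
    Module.finrank k (U.map f) + Module.finrank k ↥(U ⊓ LinearMap.ker f) = Module.finrank k U := by
  have h := LinearMap.finrank_range_add_finrank_ker (f.domRestrict U)
  rwa [LinearMap.range_domRestrict, LinearMap.ker_domRestrict,
    ← Submodule.finrank_map_subtype_eq, Submodule.map_comap_subtype] at h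

/-- The dimension of the `n`-th power of a finite-dimensional space of linear forms is eventually
a polynomial in `n`. -/
theorem eventuallyPolynomial_finrank_pow (𝒜 : ℕ → Submodule k B) [GradedAlgebra 𝒜]
    {E : Submodule k B} (hE : E ≤ 𝒜 1) (hEfg : E.FG) :
    EventuallyPolynomial (fun n => (Module.finrank k ↥(E ^ n) : ℚ)) := by
  classical
  obtain ⟨S, rfl⟩ := hEfg
  set φ : MvPolynomial S k →ₐ[k] B := MvPolynomial.aeval (fun i : S => (i : B)) with hφ
  have hmap (n : ℕ) :
      (homogeneousSubmodule S k n).map φ.toLinearMap = Submodule.span k (S : Set B) ^ n := by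
    rw [← homogeneousSubmodule_one_pow, Submodule.map_pow, homogeneousSubmodule_one_eq_span_X,
      Submodule.map_span, ← Set.range_comp]
    congr 2
    ext b
    simp [hφ]
  have hmem (n : ℕ) (p : MvPolynomial S k) (hp : p ∈ homogeneousSubmodule S k n) :
      φ p ∈ 𝒜 n := by
    have h1 : φ p ∈ Submodule.span k (S : Set B) ^ n := hmap n ▸ ⟨p, hp, rfl⟩
    have h2 (n : ℕ) : Submodule.span k (S : Set B) ^ n ≤ 𝒜 n := by
      induction n with
      | zero =>
        rw [pow_zero, Submodule.one_le]
        exact SetLike.GradedOne.one_mem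
      | succ n ih =>
        rw [pow_succ, Submodule.mul_le]
        exact fun x hx y hy => SetLike.GradedMul.mul_mem (ih hx) (hE hy)
    exact h2 n h1
  have hcomp (p : MvPolynomial S k) (n : ℕ) :
      φ (homogeneousComponent n p) = GradedRing.proj 𝒜 n (φ p) := by
    have hhom (m : ℕ) (q : MvPolynomial S k) (hq : q ∈ homogeneousSubmodule S k m) :
        φ (homogeneousComponent n q) = GradedRing.proj 𝒜 n (φ q) := by
      rw [homogeneousComponent_of_mem hq, GradedRing.proj_apply]
      split_ifs with h
      · rw [h, DirectSum.decompose_of_mem_same 𝒜 (hmem m q hq)]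
      · rw [DirectSum.decompose_of_mem_ne 𝒜 (hmem m q hq) (Ne.symm h), map_zero]
    induction p using MvPolynomial.induction_on' with
    | monomial u a => exact hhom u.degree _ (isHomogeneous_monomial a rfl)
    | add p q hp hq => rw [map_add, map_add, map_add, map_add, hp, hq]
  have hI : ComponentClosed (RingHom.ker φ) := by
    intro p hp n
    rw [RingHom.mem_ker] at hp ⊢
    rw [hcomp, hp, map_zero]
  convert eventuallyPolynomial_hilbertFun hI using 2 with n
  have hfin : Module.Finite k (homogeneousSubmodule S k n) :=
    Module.Finite.iff_fg.2 (homogeneousSubmodule_fg S k n)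
  have h := Submodule.finrank_map_add_finrank_inf_ker φ.toLinearMap (homogeneousSubmodule S k n)
  rw [hmap] at h
  rw [hilbertFun, ← h]
  push_cast
  exact (add_sub_cancel_right _ _).symm

end PowerSubmodule

open Filter Polynomial in
/-- An eventually polynomial sequence of natural numbers whose partial sums are `O(N ^ d)` has
a limit after division by `n ^ (d - 1)`. -/
theorem EventuallyPolynomial.tendsto_div_pow {f : ℕ → ℕ}
    (hf : EventuallyPolynomial (fun n => (f n : ℚ))) {C d : ℕ}
    (hC : ∀ N, 0 < N → ∑ n ∈ Finset.range N, f n ≤ C * N ^ d) :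
    ∃ L : ℝ, Tendsto (fun n : ℕ => (f n : ℝ) / (n : ℝ) ^ (d - 1)) atTop (nhds L) := by
  obtain ⟨P₀, hP₀⟩ := hf
  set P : ℝ[X] := P₀.map (algebraMap ℚ ℝ) with hP
  have hfP : ∀ᶠ n : ℕ in atTop, (f n : ℝ) = P.eval (n : ℝ) := by
    filter_upwards [hP₀] with n hn
    have h1 : ((f n : ℚ) : ℝ) = ((P₀.eval (n : ℚ) : ℚ) : ℝ) := congrArg _ hn
    rw [hP, ← map_natCast (algebraMap ℚ ℝ) n, eval_map_algebraMap, aeval_algebraMap_apply]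
    simpa using h1
  have hdeg : P.natDegree ≤ d - 1 := by
    by_contra! hlt
    set e := P.natDegree with he
    have hP0 : P ≠ 0 := by
      rintro h
      rw [h, natDegree_zero] at he
      omega
    have hlim : Tendsto (fun n : ℕ => (f n : ℝ) / (n : ℝ) ^ e) atTop (nhds P.leadingCoeff) := by
      have h1 := (div_tendsto_atTop_leadingCoeff_div_of_degree_eq P (X ^ e)
        (by rw [degree_X_pow, degree_eq_natDegree hP0])).comp tendsto_natCast_atTop_atTop
      rw [leadingCoeff_X_pow, div_one] at h1
      refine h1.congr' ?_
      filter_upwards [hfP] with n hn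
      simp [hn]
    have hpos : 0 < P.leadingCoeff :=
      lt_of_le_of_ne (ge_of_tendsto' hlim fun n => by positivity) (leadingCoeff_ne_zero.2 hP0).symm
    set c := P.leadingCoeff / 2 with hc
    have hc0 : 0 < c := by positivity
    obtain ⟨N₀, hN₀⟩ := eventually_atTop.1 (hlim.eventually_const_le (u := c) (by linarith))
    obtain ⟨M, hM⟩ := exists_nat_gt (C * 2 ^ d / c : ℝ)
    set N := max (max N₀ M) 1 with hN
    have hN1 : 1 ≤ N := le_max_right _ _
    have hNN₀ : N₀ ≤ N := (le_max_left _ _).trans (le_max_left _ _)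
    have hNM : M ≤ N := (le_max_right _ _).trans (le_max_left _ _)
    have hN1' : (1 : ℝ) ≤ N := by exact_mod_cast hN1
    have hlow : (N : ℝ) * (c * N ^ e) ≤ ∑ n ∈ Finset.range (2 * N), (f n : ℝ) := by
      calc (N : ℝ) * (c * N ^ e) = ∑ n ∈ Finset.Ico N (2 * N), c * (N : ℝ) ^ e := by
            rw [Finset.sum_const, Nat.card_Ico, nsmul_eq_mul]
            congr 2
            omega
        _ ≤ ∑ n ∈ Finset.Ico N (2 * N), (f n : ℝ) := by
            refine Finset.sum_le_sum fun n hn => ?_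
            have hNn : N ≤ n := (Finset.mem_Ico.1 hn).1
            have hn0 : (0 : ℝ) < (n : ℝ) ^ e := by
              have : (0 : ℝ) < n := by exact_mod_cast hN1.trans hNn
              positivity
            have h1 := (le_div_iff₀ hn0).1 (hN₀ n (hNN₀.trans hNn))
            refine le_trans ?_ h1
            gcongr
        _ ≤ ∑ n ∈ Finset.range (2 * N), (f n : ℝ) := by
            refine Finset.sum_le_sum_of_subset_of_nonneg (fun n hn => ?_) fun _ _ _ => by positivity
            exact Finset.mem_range.2 (Finset.mem_Ico.1 hn).2
    have hup : ∑ n ∈ Finset.range (2 * N), (f n : ℝ) ≤ C * 2 ^ d * N ^ e := by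
      have h1 : ∑ n ∈ Finset.range (2 * N), (f n : ℝ) ≤ C * (2 * N) ^ d := by
        exact_mod_cast hC (2 * N) (by omega)
      calc _ ≤ (C : ℝ) * (2 * N) ^ d := h1
        _ = C * 2 ^ d * N ^ d := by rw [mul_pow, mul_assoc]
        _ ≤ C * 2 ^ d * N ^ e := by
          gcongr
          omega
    have hNe : (0 : ℝ) < (N : ℝ) ^ e := by positivity
    have h2 : (N : ℝ) * c ≤ C * 2 ^ d := by
      refine le_of_mul_le_mul_right ?_ hNe
      calc (N : ℝ) * c * N ^ e = N * (c * N ^ e) := mul_assoc _ _ _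
        _ ≤ C * 2 ^ d * N ^ e := hlow.trans hup
    have h3 : (C * 2 ^ d / c : ℝ) < N := hM.trans_le (by exact_mod_cast hNM)
    rw [div_lt_iff₀ hc0] at h3
    exact absurd h2 (not_le.2 h3)
  have hdeg' : P.degree ≤ (X ^ (d - 1) : ℝ[X]).degree := by
    rw [degree_X_pow]
    exact degree_le_of_natDegree_le hdeg
  obtain ⟨L, hL⟩ : ∃ L : ℝ, Tendsto (fun x => eval x P / eval x (X ^ (d - 1))) atTop (nhds L) := by
    rcases hdeg'.eq_or_lt with h | h
    · exact ⟨_, div_tendsto_atTop_leadingCoeff_div_of_degree_eq _ _ h⟩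
    · exact ⟨0, div_tendsto_atTop_zero_of_degree_lt _ _ h⟩
  refine ⟨L, (hL.comp tendsto_natCast_atTop_atTop).congr' ?_⟩
  filter_upwards [hfP] with n hn
  simp [hn]


/-- **Proposition 2.17.**  Let `B = ⊕_{n ≥ 0} B_n` be a reduced standard graded algebra over a
field `k` and let `A = ⊕_{n ≥ 0} A_n` be a standard graded `k`-subalgebra of `B` (so
`A_n = E ^ n` for `E = A_1 ≤ B_1`).  Then
`ε(A ∣ B) = lim_{n → ∞} ((dim B - 1)! / n^{dim B - 1}) · dim_k (B_n / A_n)` exists as a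
finite limit. -/
theorem epsilon_mult_stmt17
    {k B : Type*} [Field k] [CommRing B] [IsReduced B] [Algebra k B]
    (𝒜 : ℕ → Submodule k B) [GradedAlgebra 𝒜]
    (hstd : ∀ n, 𝒜 n = 𝒜 1 ^ n) (hfg : (𝒜 1).FG)
    (E : Submodule k B) (hE : E ≤ 𝒜 1) (hEfg : E.FG)
    (d : ℕ) (hd : ringKrullDim B = d) :
    ∃ L : ℝ, Filter.Tendsto
      (fun n : ℕ => ((Nat.factorial (d - 1) : ℝ) / (n : ℝ) ^ (d - 1)) *
        (Module.finrank k (↥(𝒜 n) ⧸ Submodule.comap (𝒜 n).subtype (E ^ n)) : ℝ))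
      Filter.atTop (nhds L) := by
  have hfin (n : ℕ) : Module.Finite k (𝒜 n) := by
    rw [hstd n]
    exact Module.Finite.iff_fg.2 (hfg.pow n)
  have hle (n : ℕ) : E ^ n ≤ 𝒜 n := by
    rw [hstd n]
    exact pow_le_pow_left' hE n
  have hadd (n : ℕ) :
      Module.finrank k (↥(𝒜 n) ⧸ Submodule.comap (𝒜 n).subtype (E ^ n)) +
        Module.finrank k ↥(E ^ n) = Module.finrank k (𝒜 n) := by
    rw [← Submodule.finrank_quotient_add_finrank (Submodule.comap (𝒜 n).subtype (E ^ n)),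
      (Submodule.comapSubtypeEquivOfLe (hle n)).finrank_eq]
  have hpoly : EventuallyPolynomial fun n =>
      (Module.finrank k (↥(𝒜 n) ⧸ Submodule.comap (𝒜 n).subtype (E ^ n)) : ℚ) := by
    convert (eventuallyPolynomial_finrank_pow 𝒜 le_rfl hfg).sub
      (eventuallyPolynomial_finrank_pow 𝒜 hE hEfg) using 2 with n
    rw [← hstd n, ← hadd n]
    push_cast
    ring
  obtain ⟨C, hC⟩ := GradedAlgebra.exists_sum_finrank_le 𝒜 hstd hfg hd
  obtain ⟨L, hL⟩ := hpoly.tendsto_div_pow (C := C) (d := d) fun N hN =>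
    (Finset.sum_le_sum fun n _ => (Nat.le_add_right _ _).trans (hadd n).le).trans (hC N hN)
  refine ⟨(Nat.factorial (d - 1) : ℝ) * L, (hL.const_mul _).congr fun n => ?_⟩
  ring
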